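/- (Geodesics on the sphere spread more slowly than in flat space.) Let a, b, c be unit vectors in ℝ^d with c ≠ ±a and c ≠ ±b. Then dist(a, b) ≤ ‖log_c(a) − log_c(b)‖, i.e. arccos⟨a, b⟩ ≤ ‖log_c(a) − log_c(b)‖. -/

import Mathlib

open RealInnerProductSpace

/-- The Riemannian logarithm map on the unit sphere:
`log_x(y) = arccos⟨y,x⟩ · P_x(y−x)/‖P_x(y−x)‖` with `P_x = I − xxᵀ`. -/
noncomputable def sphereLog {d : ℕ} (x y : EuclideanSpace ℝ (Fin d)) :
    EuclideanSpace ℝ (Fin d) :=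
  Real.arccos ⟪y, x⟫ •
    (‖(y - x) - ⟪y - x, x⟫ • x‖⁻¹ • ((y - x) - ⟪y - x, x⟫ • x))

/-- `cos ∘ √` is convex on `[0, π²]`, because `sin x / x` is antitone on `(0, π)`. -/
theorem convexOn_cos_sqrt :
    ConvexOn ℝ (Set.Icc 0 (Real.pi ^ 2)) (fun s : ℝ => Real.cos √s) := by
  have hderiv : ∀ s : ℝ, 0 < s →
      HasDerivAt (fun s : ℝ => Real.cos √s) (-Real.sin √s * (1 / (2 * √s))) s :=
    fun s hs => (Real.hasDerivAt_sqrt hs.ne').cos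
  refine MonotoneOn.convexOn_of_deriv (convex_Icc _ _) (by fun_prop) ?_ ?_
  · intro s hs
    rw [interior_Icc] at hs
    exact (hderiv s hs.1).differentiableAt.differentiableWithinAt
  · rw [interior_Icc]
    intro s hs r hr hsr
    rw [(hderiv s hs.1).deriv, (hderiv r hr.1).deriv]
    have hs0 : 0 < √s := Real.sqrt_pos.2 hs.1
    have hr0 : 0 < √r := Real.sqrt_pos.2 hr.1
    have hle : √s ≤ √r := Real.sqrt_le_sqrt hsr
    have hrpi : √r ≤ Real.pi := (Real.sqrt_le_left Real.pi_pos.le).2 hr.2.le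
    have hconc := strictConcaveOn_sin_Icc.concaveOn.2
      (Set.left_mem_Icc.2 Real.pi_pos.le) ⟨hr0.le, hrpi⟩
      (sub_nonneg.2 ((div_le_one hr0).2 hle)) (by positivity) (sub_add_cancel 1 (√s / √r))
    simp only [smul_eq_mul, Real.sin_zero, mul_zero, zero_add,
      div_mul_cancel₀ _ hr0.ne'] at hconc
    have key : Real.sin √r * √s ≤ Real.sin √s * √r := by
      rw [div_mul_eq_mul_div, div_le_iff₀ hr0] at hconc
      linarith
    have hdiv : Real.sin √r / (2 * √r) ≤ Real.sin √s / (2 * √s) := by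
      rw [div_le_div_iff₀ (by positivity) (by positivity)]
      linarith
    simpa only [mul_one_div, neg_div, neg_le_neg_iff] using hdiv

/-- Comparison of the spherical and the Euclidean law of cosines for two sides `α`, `β`
enclosing an angle with cosine `t`. -/
theorem cos_sqrt_le_spherical_cos {α β t : ℝ} (hα : 0 < α) (hα' : α < Real.pi)
    (hβ : 0 < β) (hβ' : β < Real.pi) (ht : -1 ≤ t) (ht' : t ≤ 1)
    (hpi : α ^ 2 + β ^ 2 - 2 * α * β * t ≤ Real.pi ^ 2) :
    Real.cos √(α ^ 2 + β ^ 2 - 2 * α * β * t) ≤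
      Real.cos α * Real.cos β + Real.sin α * Real.sin β * t := by
  have hαβ : 0 < α * β := mul_pos hα hβ
  have hsin : 0 ≤ Real.sin α * Real.sin β :=
    mul_nonneg (Real.sin_nonneg_of_nonneg_of_le_pi hα.le hα'.le)
      (Real.sin_nonneg_of_nonneg_of_le_pi hβ.le hβ'.le)
  let k : ℝ := Real.sin α * Real.sin β / (2 * α * β)
  have hk : k * (2 * α * β) = Real.sin α * Real.sin β :=
    div_mul_cancel₀ _ (by positivity)
  have hk0 : 0 ≤ k := div_nonneg hsin (by positivity)
  let L : ℝ → ℝ := fun s => Real.cos α * Real.cos β + k * (α ^ 2 + β ^ 2 - s)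
  have hend : ∀ q, q ≤ Real.pi ^ 2 → α ^ 2 + β ^ 2 - 2 * α * β * t ≤ q →
      Real.cos √q ≤ L q → Real.cos √(α ^ 2 + β ^ 2 - 2 * α * β * t) ≤
        Real.cos α * Real.cos β + Real.sin α * Real.sin β * t := by
    intro q hq hsq hcos
    have hp : (α - β) ^ 2 ≤ α ^ 2 + β ^ 2 - 2 * α * β * t := by nlinarith
    have hconv : ConvexOn ℝ (Set.Icc 0 (Real.pi ^ 2)) (fun s : ℝ => Real.cos √s - L s) := by
      refine convexOn_cos_sqrt.sub ⟨convex_Icc _ _, ?_⟩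
      intro x _ y _ u v _ _ huv
      simp only [L, smul_eq_mul]
      obtain rfl : v = 1 - u := by linarith
      apply le_of_eq
      ring
    have hmax := hconv.le_max_of_mem_Icc (x := (α - β) ^ 2) (y := q)
      ⟨sq_nonneg _, by linarith⟩ ⟨by linarith [sq_nonneg (α - β)], hq⟩ ⟨hp, hsq⟩
    have hleft : Real.cos √((α - β) ^ 2) - L ((α - β) ^ 2) ≤ 0 := by
      rw [Real.sqrt_sq_eq_abs, Real.cos_abs, Real.cos_sub]
      simp only [L]
      linear_combination -hk
    have := hmax.trans (max_le hleft (sub_nonpos.2 hcos))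
    simp only [L] at this
    linear_combination this + t * hk
  have hL : L ((α + β) ^ 2) = Real.cos (α + β) := by
    rw [Real.cos_add]
    simp only [L]
    linear_combination -hk
  rcases le_total (α + β) Real.pi with h | h
  · refine hend ((α + β) ^ 2) (by gcongr) (by nlinarith) ?_
    rw [hL, Real.sqrt_sq (by positivity)]
  · refine hend (Real.pi ^ 2) le_rfl hpi ?_
    rw [Real.sqrt_sq Real.pi_pos.le, Real.cos_pi]
    have hmono : L ((α + β) ^ 2) ≤ L (Real.pi ^ 2) := by
      have : Real.pi ^ 2 ≤ (α + β) ^ 2 := by gcongr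
      simp only [L]
      gcongr
    linarith [Real.neg_one_le_cos (α + β)]

theorem real_inner_mem_Ioo_of_ne {E : Type*} [NormedAddCommGroup E] [InnerProductSpace ℝ E]
    {x y : E} (hx : ‖x‖ = 1) (hy : ‖y‖ = 1) (h : y ≠ x) (h' : y ≠ -x) :
    ⟪x, y⟫ ∈ Set.Ioo (-1 : ℝ) 1 := by
  refine ⟨?_, inner_lt_one_iff_real_of_norm_eq_one hx hy |>.2 h.symm⟩
  have := (inner_lt_one_iff_real_of_norm_eq_one (x := -x) (y := y) (by simpa) hy).2 h'.symm
  rw [inner_neg_left] at this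
  linarith

/-- geodesics on the sphere spread more slowly than in flat space.
For unit vectors `a, b, c` with `c ≠ ±a` and `c ≠ ±b`,
`dist(a,b) = arccos⟨a,b⟩ ≤ ‖log_c(a) − log_c(b)‖`. -/
theorem stmt_11 {d : ℕ} (hd : 2 ≤ d)
    (a b c : EuclideanSpace ℝ (Fin d))
    (ha : ‖a‖ = 1) (hb : ‖b‖ = 1) (hc : ‖c‖ = 1)
    (hca : c ≠ a) (hca' : c ≠ -a) (hcb : c ≠ b) (hcb' : c ≠ -b) :
    Real.arccos ⟪a, b⟫ ≤ ‖sphereLog c a - sphereLog c b‖ := by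
  obtain ⟨ha1, ha2⟩ := real_inner_mem_Ioo_of_ne ha hc hca hca'
  obtain ⟨hb1, hb2⟩ := real_inner_mem_Ioo_of_ne hb hc hcb hcb'
  have hproj : ∀ y : EuclideanSpace ℝ (Fin d),
      (y - c) - ⟪y - c, c⟫ • c = y - ⟪y, c⟫ • c := by
    intro y
    rw [inner_sub_left, real_inner_self_eq_norm_sq, hc]
    module
  have hinner : ∀ x y : EuclideanSpace ℝ (Fin d),
      ⟪x - ⟪x, c⟫ • c, y - ⟪y, c⟫ • c⟫ = ⟪x, y⟫ - ⟪x, c⟫ * ⟪y, c⟫ := by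
    intro x y
    simp only [inner_sub_left, inner_sub_right, real_inner_smul_left, real_inner_smul_right,
      real_inner_self_eq_norm_sq, hc, real_inner_comm c]
    ring
  have hnorm : ∀ y : EuclideanSpace ℝ (Fin d), ‖y‖ = 1 →
      ‖y - ⟪y, c⟫ • c‖ = Real.sin (Real.arccos ⟪y, c⟫) := by
    intro y hy
    rw [Real.sin_arccos, norm_eq_sqrt_real_inner, hinner, real_inner_self_eq_norm_sq, hy]
    ring_nf
  have hα : 0 < Real.arccos ⟪a, c⟫ := Real.arccos_pos.2 ha2
  have hβ : 0 < Real.arccos ⟪b, c⟫ := Real.arccos_pos.2 hb2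
  have hα' : Real.arccos ⟪a, c⟫ < Real.pi := Real.arccos_lt_pi.2 ha1
  have hβ' : Real.arccos ⟪b, c⟫ < Real.pi := Real.arccos_lt_pi.2 hb1
  have hcosα : Real.cos (Real.arccos ⟪a, c⟫) = ⟪a, c⟫ := Real.cos_arccos ha1.le ha2.le
  have hcosβ : Real.cos (Real.arccos ⟪b, c⟫) = ⟪b, c⟫ := Real.cos_arccos hb1.le hb2.le
  have hnu := hnorm a ha
  have hnv := hnorm b hb
  have huv := hinner a b
  simp only [sphereLog, hproj]
  set α := Real.arccos ⟪a, c⟫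
  set β := Real.arccos ⟪b, c⟫
  set u := a - ⟪a, c⟫ • c
  set v := b - ⟪b, c⟫ • c
  have hu : 0 < ‖u‖ := hnu ▸ Real.sin_pos_of_pos_of_lt_pi hα hα'
  have hv : 0 < ‖v‖ := hnv ▸ Real.sin_pos_of_pos_of_lt_pi hβ hβ'
  have hu1 : ‖‖u‖⁻¹ • u‖ = 1 := by
    rw [norm_smul, norm_inv, norm_norm, inv_mul_cancel₀ hu.ne']
  have hv1 : ‖‖v‖⁻¹ • v‖ = 1 := by
    rw [norm_smul, norm_inv, norm_norm, inv_mul_cancel₀ hv.ne']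
  have ht := abs_le.1 (abs_real_inner_le_norm (‖u‖⁻¹ • u) (‖v‖⁻¹ • v))
  rw [hu1, hv1, one_mul] at ht
  have hts : Real.sin α * Real.sin β * ⟪‖u‖⁻¹ • u, ‖v‖⁻¹ • v⟫ = ⟪u, v⟫ := by
    rw [← hnu, ← hnv, real_inner_smul_left, real_inner_smul_right]
    field_simp
  have hw : ‖α • (‖u‖⁻¹ • u) - β • (‖v‖⁻¹ • v)‖ ^ 2 =
      α ^ 2 + β ^ 2 - 2 * α * β * ⟪‖u‖⁻¹ • u, ‖v‖⁻¹ • v⟫ := by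
    rw [norm_sub_sq_real, norm_smul α, norm_smul β, hu1, hv1, real_inner_smul_left _ _ α,
      real_inner_smul_right _ _ β, mul_one, mul_one, Real.norm_eq_abs, Real.norm_eq_abs,
      sq_abs, sq_abs]
    ring
  rcases le_total Real.pi ‖α • (‖u‖⁻¹ • u) - β • (‖v‖⁻¹ • v)‖ with h | h
  · exact (Real.arccos_le_pi _).trans h
  · have key := cos_sqrt_le_spherical_cos hα hα' hβ hβ' ht.1 ht.2
      (by rw [← hw]; gcongr)
    rw [← hw, Real.sqrt_sq (norm_nonneg _), hts, huv, hcosα, hcosβ, add_sub_cancel] at key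
    rw [← Real.arccos_cos (norm_nonneg _) h]
    exact Real.arccos_le_arccos key
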